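/- Let v be a vertex of degree at least 3 in an acyclically edge k-critical graph G with k > Δ(G), with neighbors u, v_1,...,v_t, and let φ be an acyclic edge k-coloring of G − uv. If d(u) + d(v) ≤ k − Δ(G) + 4 and |C_φ(u) ∩ C_φ(v)| = 2, then the multiset S = F_φ(vv_1) ⊎ F_φ(vv_2) ⊎ ... ⊎ F_φ(vv_t) contains at least d(u) elements (counted with multiplicity) from C_φ(u) ∪ C_φ(v). -/

import Mathlib

open SimpleGraph Finset

universe u

variable {V : Type u}

/-- A proper edge coloring with `k` colors: distinct edges sharing a vertex get
different colors. -/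
def ProperEC (G : SimpleGraph V) {k : ℕ} (φ : Sym2 V → Fin k) : Prop :=
  ∀ e₁ ∈ G.edgeSet, ∀ e₂ ∈ G.edgeSet, e₁ ≠ e₂ → (∃ x, x ∈ e₁ ∧ x ∈ e₂) → φ e₁ ≠ φ e₂

/-- An acyclic edge coloring: proper, and no cycle of `G` uses only two colors. -/
def AcyclicEC (G : SimpleGraph V) {k : ℕ} (φ : Sym2 V → Fin k) : Prop :=
  ProperEC G φ ∧
    ∀ (v : V) (w : G.Walk v v), w.IsCycle → 2 < (w.edges.map φ).toFinset.card

/-- `G` has an acyclic edge coloring with `k` colors, i.e. `χ'_a(G) ≤ k`. -/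
def HasAEC (G : SimpleGraph V) (k : ℕ) : Prop :=
  ∃ φ : Sym2 V → Fin k, AcyclicEC G φ

/-- `G` is acyclically edge `k`-critical: `χ'_a(G) > k` but every proper subgraph
admits an acyclic edge `k`-coloring. -/
def AcyclicallyEdgeCritical (G : SimpleGraph V) (k : ℕ) : Prop :=
  ¬ HasAEC G k ∧ ∀ H : SimpleGraph V, H ≤ G → H ≠ G → HasAEC H k

/-- `C_φ(v)`: the set of colors appearing on edges incident with `v`. -/
def Cset (G : SimpleGraph V) {k : ℕ} (φ : Sym2 V → Fin k) (v : V) : Set (Fin k) :=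
  {c | ∃ u, G.Adj v u ∧ φ s(v, u) = c}

/-- `F_φ(xy)`: the set of colors appearing at `y` on edges other than `xy`. -/
def Fset (G : SimpleGraph V) {k : ℕ} (φ : Sym2 V → Fin k) (x y : V) : Set (Fin k) :=
  {c | ∃ w, G.Adj y w ∧ w ≠ x ∧ φ s(y, w) = c}

theorem AcyclicEC.mono {G H : SimpleGraph V} {k : ℕ} {φ : Sym2 V → Fin k}
    (hφ : AcyclicEC G φ) (h : H ≤ G) : AcyclicEC H φ := by
  refine ⟨fun e₁ h₁ e₂ h₂ => hφ.1 e₁ (edgeSet_mono h h₁) e₂ (edgeSet_mono h h₂), ?_⟩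
  intro v w hw
  simpa using hφ.2 v (w.mapLe h) (hw.mapLe h)

theorem ProperEC.eq_of_color_eq {G : SimpleGraph V} {k : ℕ} {φ : Sym2 V → Fin k}
    (hφ : ProperEC G φ) {x y z : V} (hy : G.Adj x y) (hz : G.Adj x z)
    (h : φ s(x, y) = φ s(x, z)) : y = z := by
  by_contra hne
  exact hφ s(x, y) hy s(x, z) hz (fun e => hne (Sym2.congr_right.1 e)) ⟨x, by simp, by simp⟩ h

/-- The subgraph of `G` formed by the edges of color `c` or `d`. -/
def bicolored (G : SimpleGraph V) {k : ℕ} (φ : Sym2 V → Fin k) (c d : Fin k) :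
    SimpleGraph V where
  Adj x y := G.Adj x y ∧ (φ s(x, y) = c ∨ φ s(x, y) = d)
  symm := ⟨fun x y h => by rwa [G.adj_comm, Sym2.eq_swap]⟩
  loopless := ⟨fun x h => G.loopless.irrefl x h.1⟩

theorem bicolored_comm (G : SimpleGraph V) {k : ℕ} (φ : Sym2 V → Fin k) (c d : Fin k) :
    bicolored G φ c d = bicolored G φ d c := by
  ext x y
  simp only [bicolored, or_comm]

theorem bicolored_le (G : SimpleGraph V) {k : ℕ} (φ : Sym2 V → Fin k) (c d : Fin k) :
    bicolored G φ c d ≤ G :=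
  fun _ _ h => h.1

/-- In a graph of maximum degree two, two paths that leave their common start in the same
direction and end at vertices of degree at most one have the same end. -/
theorem eq_of_isPath_of_isPath {K : SimpleGraph V}
    (h2 : ∀ a b c d, K.Adj a b → K.Adj a c → K.Adj a d → b = c ∨ b = d ∨ c = d) {y z : V}
    (hy : ∀ b c, K.Adj y b → K.Adj y c → b = c) (hz : ∀ b c, K.Adj z b → K.Adj z c → b = c)
    {a b : V} (hab : K.Adj a b) (p : K.Walk a y) (q : K.Walk a z) (hp : p.IsPath)
    (hq : q.IsPath) (hbp : b ∉ p.support) (hbq : b ∉ q.support) : y = z := by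
  induction p generalizing b with
  | nil =>
    cases q with
    | nil => rfl
    | cons h q =>
      obtain rfl := hy _ _ hab h
      simp at hbq
  | cons h p ih =>
    cases q with
    | nil =>
      obtain rfl := hz _ _ hab h
      simp at hbp
    | cons h' q =>
      simp only [Walk.support_cons, List.mem_cons, not_or] at hbp hbq
      rw [Walk.cons_isPath_iff] at hp hq
      rcases h2 _ _ _ _ hab h h' with rfl | rfl | rfl
      · exact absurd p.start_mem_support hbp.2
      · exact absurd q.start_mem_support hbq.2
      · exact ih hy h.symm q hp.1 hq.1 hp.2 hq.2

theorem eq_of_reachable_of_reachable {K : SimpleGraph V}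
    (h2 : ∀ a b c d, K.Adj a b → K.Adj a c → K.Adj a d → b = c ∨ b = d ∨ c = d) {x y z : V}
    (hx : ∀ b c, K.Adj x b → K.Adj x c → b = c) (hy : ∀ b c, K.Adj y b → K.Adj y c → b = c)
    (hz : ∀ b c, K.Adj z b → K.Adj z c → b = c) (hxy : x ≠ y) (hxz : x ≠ z)
    (hy' : K.Reachable x y) (hz' : K.Reachable x z) : y = z := by
  obtain ⟨p, hp⟩ := hy'.exists_isPath
  obtain ⟨q, hq⟩ := hz'.exists_isPath
  cases p with
  | nil => exact absurd rfl hxy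
  | cons h p =>
    cases q with
    | nil => exact absurd rfl hxz
    | cons h' q =>
      rw [Walk.cons_isPath_iff] at hp hq
      obtain rfl := hx _ _ h h'
      exact eq_of_isPath_of_isPath h2 hy hz h.symm p q hp.1 hq.1 hp.2 hq.2

theorem exists_color_of_reachable {H : SimpleGraph V} {k : ℕ} {φ : Sym2 V → Fin k}
    {c d : Fin k} {x y : V} (hxy : x ≠ y) (h : (bicolored H φ c d).Reachable x y) :
    c ∈ Cset H φ x ∨ d ∈ Cset H φ x := by
  obtain ⟨p⟩ := h
  cases p with
  | nil => exact absurd rfl hxy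
  | cons h p => exact h.2.imp (fun e => ⟨_, h.1, e⟩) (fun e => ⟨_, h.1, e⟩)

/-- A bicolored path has at most two ends. -/
theorem ProperEC.eq_of_reachable {H : SimpleGraph V} {k : ℕ} {φ : Sym2 V → Fin k}
    (hφ : ProperEC H φ) {c d : Fin k} {x y z : V}
    (hx : c ∉ Cset H φ x ∨ d ∉ Cset H φ x) (hy : c ∉ Cset H φ y ∨ d ∉ Cset H φ y)
    (hz : c ∉ Cset H φ z ∨ d ∉ Cset H φ z) (hxy : x ≠ y) (hxz : x ≠ z)
    (hy' : (bicolored H φ c d).Reachable x y) (hz' : (bicolored H φ c d).Reachable x z) :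
    y = z := by
  have key : ∀ x, c ∉ Cset H φ x ∨ d ∉ Cset H φ x → ∀ a b, (bicolored H φ c d).Adj x a →
      (bicolored H φ c d).Adj x b → a = b := by
    rintro x hx a b ⟨ha, ha'⟩ ⟨hb, hb'⟩
    apply hφ.eq_of_color_eq ha hb
    rcases hx with hx | hx
    · have : ∀ w, H.Adj x w → φ s(x, w) ≠ c := fun w hw e => hx ⟨w, hw, e⟩
      grind
    · have : ∀ w, H.Adj x w → φ s(x, w) ≠ d := fun w hw e => hx ⟨w, hw, e⟩
      grind
  refine eq_of_reachable_of_reachable ?_ (key x hx) (key y hy) (key z hz) hxy hxz hy' hz'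
  rintro a b c' d' ⟨hb, hb'⟩ ⟨hc, hc'⟩ ⟨hd, hd'⟩
  have h1 := hφ.eq_of_color_eq hb hc
  have h2 := hφ.eq_of_color_eq hb hd
  have h3 := hφ.eq_of_color_eq hc hd
  grind

/-- Giving the edge from a deleted vertex to each `x ∈ N` the color `f x` extends the coloring `φ`
of `H` to an acyclic one. -/
structure AcyclicStar (H : SimpleGraph V) {k : ℕ} (φ : Sym2 V → Fin k) (N : Set V)
    (f : V → Fin k) : Prop where
  injOn : Set.InjOn f N
  notMem : ∀ x ∈ N, f x ∉ Cset H φ x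
  not_reachable : ∀ x ∈ N, ∀ y ∈ N, x ≠ y → ¬ (bicolored H φ (f x) (f y)).Reachable x y

theorem AcyclicEC.acyclicStar {G : SimpleGraph V} {k : ℕ} {φ : Sym2 V → Fin k}
    (hφ : AcyclicEC G φ) (v : V) :
    AcyclicStar (G.deleteIncidenceSet v) φ (G.neighborSet v) (fun x => φ s(v, x)) := by
  refine ⟨fun x hx y hy h => hφ.1.eq_of_color_eq hx hy h, ?_, ?_⟩
  · rintro x hx ⟨w, hw, h⟩
    rw [deleteIncidenceSet_adj] at hw
    refine hw.2.2 (hφ.1.eq_of_color_eq hw.1 (G.adj_symm hx) ?_)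
    rw [h, Sym2.eq_swap]
  · intro x hx y hy hxy hr
    rw [mem_neighborSet] at hx hy
    set K := bicolored (G.deleteIncidenceSet v) φ (φ s(v, x)) (φ s(v, y))
    obtain ⟨p, hp⟩ := hr.exists_isPath
    have hKG : K ≤ G := (bicolored_le _ _ _ _).trans (deleteIncidenceSet_le _ _)
    have hvp : v ∉ p.support := by
      have : ∀ {a b : V} (p : K.Walk a b), a ≠ v → v ∉ p.support := by
        intro a b p ha
        induction p with
        | nil => simpa using ha.symm
        | cons h p ih =>
          have := (deleteIncidenceSet_adj.1 h.1).2.2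
          simpa [ha.symm] using ih this
      exact this p hx.ne'
    let q := ((p.mapLe hKG).concat hy.symm).cons hx
    have hq : q.IsCycle := by
      refine (Walk.cons_isCycle_iff _ _).2
        ⟨(hp.mapLe hKG).concat (by simpa using hvp) _, ?_⟩
      rw [Walk.edges_concat, Walk.edges_mapLe_eq_edges, List.concat_eq_append, List.mem_append,
        List.mem_singleton]
      rintro (h | h)
      · exact hvp (p.fst_mem_support_of_mem_edges h)
      · rw [Sym2.eq_swap, Sym2.congr_left] at h
        exact hxy h
    refine absurd (hφ.2 v q hq) (not_lt.2 ?_)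
    refine (Finset.card_le_card ?_).trans (Finset.card_le_two (a := φ s(v, x)) (b := φ s(v, y)))
    intro c hc
    simp only [q, Walk.edges_cons, Walk.edges_concat, Walk.edges_mapLe_eq_edges,
      List.concat_eq_append, List.mem_toFinset, List.mem_map, List.mem_cons, List.mem_append,
      List.not_mem_nil, or_false] at hc
    obtain ⟨e, he | he | he, rfl⟩ := hc
    · simp [he]
    · have := p.edges_subset_edgeSet he
      induction e with
      | _ a b => simpa using this.2
    · simp [he, Sym2.eq_swap]

theorem AcyclicStar.hasAEC {G : SimpleGraph V} {k : ℕ} {φ : Sym2 V → Fin k} {v : V}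
    {f : V → Fin k} (hφ : AcyclicEC (G.deleteIncidenceSet v) φ)
    (hf : AcyclicStar (G.deleteIncidenceSet v) φ (G.neighborSet v) f) : HasAEC G k := by
  classical
  let ψ : Sym2 V → Fin k := fun e => if h : v ∈ e then f (Sym2.Mem.other h) else φ e
  have hψv : ∀ x, ψ s(v, x) = f x := by
    intro x
    have h : v ∈ s(v, x) := by simp
    simp only [ψ, dif_pos h]
    rw [Sym2.congr_right.1 (Sym2.other_spec h)]
  have hψ : ∀ e, v ∉ e → ψ e = φ e := fun e h => dif_neg h
  have hψ' : ∀ a b, a ≠ v → b ≠ v → ψ s(a, b) = φ s(a, b) := fun a b ha hb =>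
    hψ _ (by simp [ha.symm, hb.symm])
  have hproper : ∀ x y z, G.Adj x y → G.Adj x z → y ≠ z → ψ s(x, y) ≠ ψ s(x, z) := by
    have hout : ∀ x y, G.Adj x y → G.Adj x v → y ≠ v → ψ s(x, y) ≠ ψ s(x, v) := by
      intro x y hy hv hyv h
      rw [hψ' x y hv.ne hyv, Sym2.eq_swap (a := x) (b := v), hψv] at h
      exact hf.notMem x hv.symm ⟨y, deleteIncidenceSet_adj.2 ⟨hy, hv.ne, hyv⟩, h⟩
    intro x y z hy hz hyz h
    by_cases hxv : x = v
    · subst hxv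
      rw [hψv, hψv] at h
      exact hyz (hf.injOn hy hz h)
    by_cases hyv : y = v
    · subst hyv
      exact hout x z hz hy hyz.symm h.symm
    by_cases hzv : z = v
    · subst hzv
      exact hout x y hy hz hyz h
    rw [hψ' x y hxv hyv, hψ' x z hxv hzv] at h
    exact hyz (hφ.1.eq_of_color_eq (deleteIncidenceSet_adj.2 ⟨hy, hxv, hyv⟩)
      (deleteIncidenceSet_adj.2 ⟨hz, hxv, hzv⟩) h)
  have hmem : ∀ e ∈ G.edgeSet, v ∉ e → e ∈ (G.deleteIncidenceSet v).edgeSet := by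
    intro e he hv
    rw [edgeSet_deleteIncidenceSet]
    exact ⟨he, fun h => hv h.2⟩
  refine ⟨ψ, ?_, ?_⟩
  · rintro e₁ h₁ e₂ h₂ hne ⟨x, hx₁, hx₂⟩
    obtain ⟨y, rfl⟩ := hx₁
    obtain ⟨z, rfl⟩ := hx₂
    exact hproper x y z h₁ h₂ (fun h => hne (by rw [h]))
  · intro a w hw
    by_cases hv : v ∈ w.support
    · suffices ∀ w : G.Walk v v, w.IsCycle → 2 < (w.edges.map ψ).toFinset.card by
        convert this (w.rotate v hv) (hw.rotate hv) using 2
        ext c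
        simp only [List.mem_toFinset, List.mem_map, (w.rotate_edges v hv).mem_iff]
      intro w hw
      by_contra! hcard
      cases w with
      | nil => simp at hw
      | @cons _ x _ hx p =>
        rw [Walk.cons_isCycle_iff] at hw
        obtain ⟨q, rfl⟩ : ∃ q, p = Walk.reverse q := ⟨p.reverse, by simp⟩
        cases q with
        | nil => exact hx.ne rfl
        | @cons _ y _ hy r =>
          simp only [Walk.edges_cons, Walk.edges_reverse, List.mem_reverse, List.map_cons,
            Walk.isPath_reverse_iff, List.mem_cons, not_or, Walk.cons_isPath_iff] at hw hcard
          have hxy : x ≠ y := fun h => hw.2.1 (by rw [h])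
          have hcolors : ({f x, f y} : Finset (Fin k)) =
              (ψ s(v, x) :: ((s(v, y) :: r.edges).reverse.map ψ)).toFinset := by
            apply Finset.eq_of_subset_of_card_le
            · intro c hc
              simp only [Finset.mem_insert, Finset.mem_singleton] at hc
              rcases hc with rfl | rfl <;> simp [hψv]
            · rwa [Finset.card_pair (fun h => hxy (hf.injOn hx hy h))]
          refine hf.not_reachable x hx y hy hxy (Reachable.symm ⟨r.transfer _ ?_⟩)
          intro e he
          have hve : v ∉ e := fun h => hw.1.2 (r.mem_support_of_mem_edges he h)
          have hc : ψ e ∈ ({f x, f y} : Finset (Fin k)) := by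
            rw [hcolors, List.mem_toFinset]
            simp only [List.mem_cons, List.mem_map, List.mem_reverse]
            exact Or.inr ⟨e, Or.inr he, rfl⟩
          have hadj := hmem e (r.edges_subset_edgeSet he) hve
          rw [hψ e hve] at hc
          induction e with
          | _ a b => exact ⟨hadj, by simpa using hc⟩
    · have hve : ∀ e ∈ w.edges, v ∉ e := fun e he h =>
        hv (w.mem_support_of_mem_edges he h)
      have he : ∀ e ∈ w.edges, e ∈ (G.deleteIncidenceSet v).edgeSet := fun e he =>
        hmem e (w.edges_subset_edgeSet he) (hve e he)
      have := hφ.2 a (w.transfer _ he) (hw.transfer he)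
      rw [Walk.edges_transfer] at this
      rwa [List.map_congr_left fun e h => hψ e (hve e h)]

/-- The finite set of colors at `x`. -/
noncomputable def colorFinset (H : SimpleGraph V) {k : ℕ} (φ : Sym2 V → Fin k) (x : V) :
    Finset (Fin k) :=
  (Set.toFinite (Cset H φ x)).toFinset

theorem mem_colorFinset {H : SimpleGraph V} {k : ℕ} {φ : Sym2 V → Fin k} {x : V} {c : Fin k} :
    c ∈ colorFinset H φ x ↔ c ∈ Cset H φ x :=
  Set.Finite.mem_toFinset _

theorem color_mem_of_reachable {H : SimpleGraph V} {k : ℕ} {φ : Sym2 V → Fin k} {N : Set V}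
    {f : V → Fin k} (hf : ∀ x ∈ N, f x ∉ Cset H φ x) {x y : V} (hy : y ∈ N)
    (hxy : x ≠ y) (h : (bicolored H φ (f x) (f y)).Reachable x y) : f x ∈ Cset H φ y :=
  (exists_color_of_reachable hxy.symm h.symm).resolve_right (hf y hy)

/-- If a star coloring on `N` does not extend to `u` by a color `β` new to both `u` and the star,
then some bicolored path from `u` to `N` obstructs. -/
theorem AcyclicStar.exists_reachable {H : SimpleGraph V} {k : ℕ} {φ : Sym2 V → Fin k} {N : Set V}
    {f : V → Fin k} {u : V} (hf : AcyclicStar H φ N f)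
    (hext : ∀ f, ¬ AcyclicStar H φ (insert u N) f) (hu : u ∉ N) {β : Fin k}
    (hβu : β ∉ Cset H φ u) (hβ : ∀ x ∈ N, f x ≠ β) :
    ∃ y ∈ N, f y ∈ Cset H φ u ∧ (bicolored H φ β (f y)).Reachable u y := by
  classical
  by_contra! hcon
  have hN : ∀ x ∈ N, Function.update f u β x = f x := fun x hx =>
    Function.update_of_ne (by rintro rfl; exact hu hx) _ _
  have hu' : Function.update f u β u = β := Function.update_self _ _ _
  have hr : ∀ y ∈ N, ¬ (bicolored H φ β (f y)).Reachable u y := fun y hy h =>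
    hcon y hy ((exists_color_of_reachable (by rintro rfl; exact hu hy) h).resolve_left hβu) h
  refine hext (Function.update f u β) ⟨?_, ?_, ?_⟩
  · rintro x (rfl | hx) y (rfl | hy) h
    · rfl
    · rw [hu', hN y hy] at h
      exact absurd h.symm (hβ y hy)
    · rw [hu', hN x hx] at h
      exact absurd h (hβ x hx)
    · rw [hN x hx, hN y hy] at h
      exact hf.injOn hx hy h
  · rintro x (rfl | hx)
    · rwa [hu']
    · rw [hN x hx]
      exact hf.notMem x hx
  · rintro x (rfl | hx) y (rfl | hy) hxy h
    · exact hxy rfl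
    · rw [hu', hN y hy] at h
      exact hr y hy h
    · rw [hu', hN x hx, bicolored_comm] at h
      exact hr x hx h.symm
    · rw [hN x hx, hN y hy] at h
      exact hf.not_reachable x hx y hy hxy h

/-- Replacing the color at `p` by a color that appears at no vertex of `N` keeps a star coloring
acyclic. -/
theorem AcyclicStar.update {H : SimpleGraph V} {k : ℕ} {φ : Sym2 V → Fin k} {N : Set V}
    [DecidableEq V] {g : V → Fin k} (hg : AcyclicStar H φ N g) (p : V) {m : Fin k}
    (hm : ∀ x ∈ N, m ∉ Cset H φ x) (hmg : ∀ x ∈ N, g x ≠ m) :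
    AcyclicStar H φ N (Function.update g p m) := by
  have hnotMem : ∀ x ∈ N, Function.update g p m x ∉ Cset H φ x := by
    intro x hx
    rcases eq_or_ne x p with rfl | hxp
    · rw [Function.update_self]
      exact hm x hx
    · rw [Function.update_of_ne hxp]
      exact hg.notMem x hx
  refine ⟨?_, hnotMem, ?_⟩
  · intro x hx y hy h
    rcases eq_or_ne x p with rfl | hxp <;> rcases eq_or_ne y x with rfl | hyx
    · rfl
    · rw [Function.update_self, Function.update_of_ne hyx] at h
      exact absurd h.symm (hmg y hy)
    · rfl
    · rw [Function.update_of_ne hxp] at h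
      rcases eq_or_ne y p with rfl | hyp
      · rw [Function.update_self] at h
        exact absurd h (hmg x hx)
      · rw [Function.update_of_ne hyp] at h
        exact hg.injOn hx hy h
  · intro x hx y hy hxy h
    have h1 := color_mem_of_reachable hnotMem hy hxy h
    have h2 := color_mem_of_reachable hnotMem hx hxy.symm (bicolored_comm H φ _ _ ▸ h.symm)
    rcases eq_or_ne x p with rfl | hxp
    · rw [Function.update_self] at h1
      exact hm y hy h1
    rcases eq_or_ne y p with rfl | hyp
    · rw [Function.update_self] at h2
      exact hm x hx h2
    rw [Function.update_of_ne hxp, Function.update_of_ne hyp] at h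
    exact hg.not_reachable x hx y hy hxy h

/-- Suppose an acyclic star coloring `g` on `N` does not extend to `u`, and `p`, `q` are the only
vertices of `N` whose star colors occur at `u`. Then the colors at `u`, other than `g q`, that occur
at no vertex of `N` are fewer than the star colors, other than `g q`, that occur at `p`. -/
theorem AcyclicStar.card_lt_card {H : SimpleGraph V} {k : ℕ} {φ : Sym2 V → Fin k} [DecidableEq V]
    (hφ : ProperEC H φ) {N : Finset V} {u p q : V} {g : V → Fin k}
    (hg : AcyclicStar H φ N g) (hext : ∀ f, ¬ AcyclicStar H φ (insert u N) f) (hu : u ∉ N)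
    (hp : p ∈ N) (hq : q ∈ N) (hpq : p ≠ q)
    (huniq : ∀ y ∈ N, g y ∈ Cset H φ u → y = p ∨ y = q)
    (hfree : ∀ x ∈ N, ∃ α, α ∉ Cset H φ u ∧ (∀ y ∈ N, g y ≠ α) ∧ α ∉ Cset H φ x) :
    (((colorFinset H φ u).filter fun c => ∀ x ∈ N, c ∉ colorFinset H φ x).erase (g q)).card <
      (((N.erase p).erase q).filter fun x => g x ∈ colorFinset H φ p).card := by
  have hN : ∀ x ∈ N, u ≠ x := fun x hx h => hu (h ▸ hx)
  have hpath : ∀ α, α ∉ Cset H φ u → (∀ y ∈ N, g y ≠ α) →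
      (bicolored H φ α (g p)).Reachable u p ∨ (bicolored H φ α (g q)).Reachable u q := by
    intro α hαu hα
    obtain ⟨y, hy, hyu, hr⟩ := hg.exists_reachable hext hu hαu hα
    rcases huniq y hy hyu with rfl | rfl
    · exact Or.inl hr
    · exact Or.inr hr
  have hend : ∀ α, ∀ x ∈ N, (bicolored H φ α (g x)).Reachable u x → α ∈ Cset H φ x := by
    intro α x hx h
    exact (exists_color_of_reachable (hN x hx).symm h.symm).resolve_right (hg.notMem x hx)
  obtain ⟨α, hαu, hαg, hαp⟩ := hfree p hp
  obtain ⟨β, hβu, hβg, hβq⟩ := hfree q hq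
  have hαq : (bicolored H φ α (g q)).Reachable u q :=
    (hpath α hαu hαg).resolve_left fun h => hαp (hend α p hp h)
  have hβ_not : ¬ (bicolored H φ β (g q)).Reachable u q := fun h => hβq (hend β q hq h)
  have hβp : (bicolored H φ β (g p)).Reachable u p := (hpath β hβu hβg).resolve_right hβ_not
  have hβα : α ≠ β := fun h => hαp (h ▸ hend β p hp hβp)
  by_contra! hcard
  set M := ((colorFinset H φ u).filter fun c => ∀ x ∈ N, c ∉ colorFinset H φ x).erase (g q)
  set I := ((N.erase p).erase q).filter fun x => g x ∈ colorFinset H φ p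
  have : Nonempty (Fin k) := ⟨α⟩
  obtain ⟨h, hmap, hinj⟩ := I.finite_toSet.exists_injOn_of_encard_le (t := (M : Set (Fin k)))
    (by simpa only [Set.encard_coe_eq_coe_finsetCard, Nat.cast_le] using hcard)
  have hM : ∀ m ∈ M, m ≠ g q ∧ m ∈ Cset H φ u ∧ ∀ x ∈ N, m ∉ Cset H φ x := by
    intro m hm
    simpa only [M, Finset.mem_erase, Finset.mem_filter, mem_colorFinset] using hm
  have hI : ∀ x, x ∈ I ↔ (x ≠ q ∧ x ≠ p ∧ x ∈ N) ∧ g x ∈ Cset H φ p := by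
    intro x
    simp only [I, Finset.mem_erase, Finset.mem_filter, mem_colorFinset]
  have hMg : ∀ m ∈ M, ∀ y ∈ N, g y = m → y = p := by
    rintro m hm y hy rfl
    refine (huniq y hy (hM _ hm).2.1).resolve_right ?_
    rintro rfl
    exact (hM _ hm).1 rfl
  have hMp : ∀ m ∈ M, (bicolored H φ β m).Reachable u p := by
    intro m hm
    rcases eq_or_ne m (g p) with rfl | hmp
    · exact hβp
    have hmg : ∀ x ∈ N, g x ≠ m := by
      intro x hx e
      obtain rfl := hMg m hm x hx e
      exact hmp e.symm
    obtain ⟨y, hy, hyu, hr⟩ := (hg.update p (hM m hm).2.2 hmg).exists_reachable hext hu hβu (by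
      intro x hx
      rcases eq_or_ne x p with rfl | hxp
      · rw [Function.update_self]
        rintro rfl
        exact hβu (hM _ hm).2.1
      · rw [Function.update_of_ne hxp]
        exact hβg x hx)
    rcases eq_or_ne y p with rfl | hyp
    · rwa [Function.update_self] at hr
    · rw [Function.update_of_ne hyp] at hyu hr
      obtain rfl := (huniq y hy hyu).resolve_left hyp
      exact absurd hr hβ_not
  let f : V → Fin k := fun x => if x = p then α else if x ∈ I then h x else g x
  have hfp : f p = α := if_pos rfl
  have hfI : ∀ x ∈ I, f x = h x := fun x hx => by
    simp only [f, if_neg ((hI x).1 hx).1.2.1, if_pos hx]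
  have hfg : ∀ x, x ≠ p → x ∉ I → f x = g x := fun x hxp hx => by
    simp only [f, if_neg hxp, if_neg hx]
  have hcases : ∀ x, x = p ∨ x ∈ I ∨ (x ≠ p ∧ x ∉ I) := fun x => by tauto
  have hnotMem : ∀ x ∈ N, f x ∉ Cset H φ x := by
    intro x hx
    rcases hcases x with rfl | hxI | ⟨hxp, hxI⟩
    · rwa [hfp]
    · rw [hfI x hxI]
      exact (hM _ (hmap hxI)).2.2 x hx
    · rw [hfg x hxp hxI]
      exact hg.notMem x hx
  have hfI_notMem : ∀ x ∈ I, ∀ y ∈ N, f x ∉ Cset H φ y := by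
    intro x hxI y hy
    rw [hfI x hxI]
    exact (hM _ (hmap hxI)).2.2 y hy
  have hp_not : ∀ y ∈ N, p ≠ y → ¬ (bicolored H φ (f p) (f y)).Reachable p y := by
    intro y hy hpy hr
    have hyC := color_mem_of_reachable hnotMem hp hpy.symm
      (bicolored_comm H φ _ _ ▸ hr.symm)
    rcases hcases y with rfl | hyI | ⟨hyp, hyI⟩
    · exact hpy rfl
    · exact hfI_notMem y hyI p hp hyC
    · rw [hfg y hyp hyI] at hyC hr
      rw [hfp] at hr
      obtain rfl : y = q := by
        by_contra hyq
        exact hyI ((hI y).2 ⟨⟨hyq, hyp, hy⟩, hyC⟩)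
      exact hN p hp (hφ.eq_of_reachable (Or.inr (hg.notMem y hy)) (Or.inl hαu) (Or.inl hαp)
        (hN y hy).symm hpy.symm hαq.symm hr.symm)
  have hf : AcyclicStar H φ N f := by
    refine ⟨?_, hnotMem, ?_⟩
    · intro x hx y hy hxy
      have hpne : ∀ y ∈ N, y ≠ p → f y ≠ α := by
        intro y hy hyp
        rcases hcases y with rfl | hyI | ⟨hyp, hyI⟩
        · exact absurd rfl hyp
        · rw [hfI y hyI]
          rintro rfl
          exact hαu (hM _ (hmap hyI)).2.1
        · rw [hfg y hyp hyI]
          exact hαg y hy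
      rcases hcases x with rfl | hxI | ⟨hxp, hxI⟩
      · by_contra hne
        exact hpne y hy (Ne.symm hne) (hxy ▸ hfp)
      · rcases hcases y with rfl | hyI | ⟨hyp, hyI⟩
        · exact absurd (hxy.trans hfp) (hpne x hx ((hI x).1 hxI).1.2.1)
        · rw [hfI x hxI, hfI y hyI] at hxy
          exact hinj hxI hyI hxy
        · rw [hfI x hxI, hfg y hyp hyI] at hxy
          exact absurd (hMg _ (hmap hxI) y hy hxy.symm) hyp
      · rcases hcases y with rfl | hyI | ⟨hyp, hyI⟩
        · exact absurd (hxy.trans hfp) (hpne x hx hxp)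
        · rw [hfI y hyI, hfg x hxp hxI] at hxy
          exact absurd (hMg _ (hmap hyI) x hx hxy) hxp
        · rw [hfg x hxp hxI, hfg y hyp hyI] at hxy
          exact hg.injOn hx hy hxy
    · intro x hx y hy hxy hr
      have hr' := bicolored_comm H φ _ _ ▸ hr.symm
      rcases hcases x with rfl | hxI | ⟨hxp, hxI⟩
      · exact hp_not y hy hxy hr
      · exact hfI_notMem x hxI y hy (color_mem_of_reachable hnotMem hy hxy hr)
      rcases hcases y with rfl | hyI | ⟨hyp, hyI⟩
      · exact hp_not x hx hxy.symm hr'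
      · exact hfI_notMem y hyI x hx (color_mem_of_reachable hnotMem hx hxy.symm hr')
      rw [hfg x hxp hxI, hfg y hyp hyI] at hr
      exact hg.not_reachable x hx y hy hxy hr
  obtain ⟨y, hy, hyu, hr⟩ := hf.exists_reachable hext hu hβu (by
    intro x hx
    rcases hcases x with rfl | hxI | ⟨hxp, hxI⟩
    · rwa [hfp]
    · rw [hfI x hxI]
      rintro rfl
      exact hβu (hM _ (hmap hxI)).2.1
    · rw [hfg x hxp hxI]
      exact hβg x hx)
  rcases hcases y with rfl | hyI | ⟨hyp, hyI⟩
  · exact hαu (hfp ▸ hyu)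
  · rw [hfI y hyI] at hr
    refine ((hI y).1 hyI).1.2.1 (hφ.eq_of_reachable (Or.inl hβu)
      (Or.inr ((hM _ (hmap hyI)).2.2 y hy)) (Or.inr ((hM _ (hmap hyI)).2.2 p hp))
      (hN y hy) (hN p hp) hr (hMp _ (hmap hyI)))
  · rw [hfg y hyp hyI] at hr hyu
    obtain rfl := (huniq y hy hyu).resolve_left hyp
    exact hβ_not hr

/-- The counting behind the multiset bound: the elements of `U` and the image of `g` in the sets
`C x`. -/
theorem card_le_sum_card_inter {V κ : Type*} [DecidableEq V] [DecidableEq κ] {N : Finset V}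
    {C : V → Finset κ} {U : Finset κ} {g : V → κ} {p q : V} (hg : Set.InjOn g N)
    (hp : p ∈ N) (hq : q ∈ N) (hpq : p ≠ q)
    (huniq : ∀ y ∈ N, g y ∈ U → y = p ∨ y = q)
    (h₁ : ((U.filter fun c => ∀ x ∈ N, c ∉ C x).erase (g q)).card <
      (((N.erase p).erase q).filter fun x => g x ∈ C p).card)
    (h₂ : ((U.filter fun c => ∀ x ∈ N, c ∉ C x).erase (g p)).card <
      (((N.erase q).erase p).filter fun x => g x ∈ C q).card) :
    U.card + 1 ≤ ∑ x ∈ N, (C x ∩ (U ∪ N.image g)).card := by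
  set M := U.filter fun c => ∀ x ∈ N, c ∉ C x
  have hsplit : ∀ x, (C x ∩ (U ∪ N.image g)).card =
      (C x ∩ U).card + (C x ∩ (N.image g \ U)).card := by
    intro x
    rw [← Finset.union_sdiff_self_eq_union, Finset.inter_union_distrib_left,
      Finset.card_union_of_disjoint]
    exact Finset.disjoint_sdiff.mono Finset.inter_subset_right Finset.inter_subset_right
  have hI : ∀ a, ((((N.erase p).erase q).filter fun x => g x ∈ C a).card) ≤
      (C a ∩ (N.image g \ U)).card := by
    intro a
    refine Finset.card_le_card_of_injOn g ?_ (hg.mono fun x hx => ?_)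
    · intro x hx
      simp only [Finset.coe_filter, Finset.mem_erase, Set.mem_ofPred_eq] at hx
      simp only [Finset.coe_inter, Finset.coe_sdiff, Set.mem_inter_iff, Finset.mem_coe,
        Set.mem_sdiff]
      refine ⟨hx.2, Finset.mem_image_of_mem g hx.1.2.2, fun hU => ?_⟩
      exact (huniq x hx.1.2.2 hU).elim hx.1.2.1 hx.1.1
    · exact Finset.mem_of_mem_erase (Finset.mem_of_mem_erase (Finset.mem_filter.1 hx).1)
  have hU : U.card ≤ M.card + ∑ x ∈ N, (C x ∩ U).card := by
    rw [← Finset.card_filter_add_card_filter_not (s := U) (fun c => ∀ x ∈ N, c ∉ C x)]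
    refine Nat.add_le_add_left (le_trans (Finset.card_le_card ?_) Finset.card_biUnion_le) _
    intro c hc
    simp only [Finset.mem_filter, not_forall, not_not] at hc
    obtain ⟨hcU, x, hx, hcx⟩ := hc
    exact Finset.mem_biUnion.2 ⟨x, hx, Finset.mem_inter.2 ⟨hcx, hcU⟩⟩
  have hW : (C p ∩ (N.image g \ U)).card + (C q ∩ (N.image g \ U)).card ≤
      ∑ x ∈ N, (C x ∩ (N.image g \ U)).card := by
    rw [← Finset.sum_pair (f := fun x => (C x ∩ (N.image g \ U)).card) hpq]
    exact Finset.sum_le_sum_of_subset (by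
      simp [Finset.insert_subset_iff, hp, hq])
  rw [Finset.sum_congr rfl fun x _ => hsplit x, Finset.sum_add_distrib]
  have hM := Finset.pred_card_le_card_erase (s := M) (a := g q)
  rw [Finset.erase_right_comm (a := q)] at h₂
  have := hI p
  have := hI q
  omega

theorem ProperEC.card_colorFinset {G : SimpleGraph V} [Fintype V] [DecidableRel G.Adj] {k : ℕ}
    {φ : Sym2 V → Fin k} {v x : V} (hφ : ProperEC (G.deleteIncidenceSet v) φ) (h : G.Adj v x) :
    (colorFinset (G.deleteIncidenceSet v) φ x).card + 1 = G.degree x := by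
  classical
  have hadj : ∀ w, (G.deleteIncidenceSet v).Adj x w ↔ w ∈ (G.neighborFinset x).erase v := by
    intro w
    rw [deleteIncidenceSet_adj, Finset.mem_erase, mem_neighborFinset]
    exact ⟨fun h => ⟨h.2.2, h.1⟩, fun h' => ⟨h'.2, h.ne', h'.1⟩⟩
  have himage : colorFinset (G.deleteIncidenceSet v) φ x =
      ((G.neighborFinset x).erase v).image fun w => φ s(x, w) := by
    ext c
    simp only [mem_colorFinset, Finset.mem_image, ← hadj]
    rfl
  rw [himage, Finset.card_image_of_injOn, Finset.card_erase_add_one, card_neighborFinset_eq_degree]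
  · simpa using h.symm
  · intro a ha b hb hab
    exact hφ.eq_of_color_eq ((hadj a).2 ha) ((hadj b).2 hb) hab

/-- Lemma on the multiset `S = F_φ(vv₁) ⊎ ⋯ ⊎ F_φ(vv_t)`: if `v` is a `3⁺`-vertex
of an acyclically edge `k`-critical graph `G` (`k > Δ(G)`) with neighbors
`u, v₁, …, v_t`, `φ` is an acyclic edge `k`-coloring of `G - uv`,
`d(u) + d(v) ≤ k - Δ(G) + 4` and `|C_φ(u) ∩ C_φ(v)| = 2`, then `S` contains at
least `d(u)` elements (with multiplicity) from `C_φ(u) ∪ C_φ(v)`. -/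
theorem critical_multiset_lemma
    {V : Type u} [Fintype V] [DecidableEq V] (G : SimpleGraph V)
    [DecidableRel G.Adj] (k : ℕ)
    (hG : AcyclicallyEdgeCritical G k) (hk : G.maxDegree < k)
    {u v : V} (huv : G.Adj u v) (hv3 : 3 ≤ G.degree v)
    (t : ℕ) (vi : Fin t → V) (hinj : Function.Injective vi)
    (hne : ∀ i, vi i ≠ u)
    (hnbr : G.neighborSet v = insert u (Set.range vi))
    (φ : Sym2 V → Fin k) (hφ : AcyclicEC (G.deleteEdges {s(u, v)}) φ)
    (hdeg : G.degree u + G.degree v ≤ k - G.maxDegree + 4)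
    (hint : (Cset (G.deleteEdges {s(u, v)}) φ u ∩
      Cset (G.deleteEdges {s(u, v)}) φ v).ncard = 2) :
    G.degree u ≤ ∑ i, (Fset (G.deleteEdges {s(u, v)}) φ v (vi i) ∩
      (Cset (G.deleteEdges {s(u, v)}) φ u ∪
        Cset (G.deleteEdges {s(u, v)}) φ v)).ncard := by
  set G' := G.deleteEdges {s(u, v)} with hG'
  set H := G.deleteIncidenceSet v
  have hadj' : ∀ x y, G'.Adj x y ↔ G.Adj x y ∧ s(x, y) ≠ s(u, v) := by
    intro x y
    rw [hG', deleteEdges_adj, Set.mem_singleton_iff]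
  have hadjH : ∀ x y, H.Adj x y ↔ G.Adj x y ∧ x ≠ v ∧ y ≠ v := fun x y => deleteIncidenceSet_adj
  have hHG' : G'.deleteIncidenceSet v = H := by
    ext x y
    rw [deleteIncidenceSet_adj, hadj', hadjH]
    refine ⟨fun h => ⟨h.1.1, h.2⟩, fun h => ⟨⟨h.1, fun e => ?_⟩, h.2⟩⟩
    rcases Sym2.eq_iff.1 e with ⟨-, e⟩ | ⟨e, -⟩
    exacts [h.2.2 e, h.2.1 e]
  set N := Finset.univ.image vi with hN
  have huN : u ∉ N := by
    simpa [N] using hne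
  have hnbr' : G.neighborSet v = insert u (N : Set V) := by
    rw [hnbr, hN, Finset.coe_image, Finset.coe_univ, Set.image_univ]
  have hNadj : ∀ x ∈ N, G.Adj v x := fun x hx => by
    rw [← mem_neighborSet, hnbr']
    exact Or.inr hx
  have hN' : G'.neighborSet v = (N : Set V) := by
    ext x
    rw [mem_neighborSet, hadj', ← mem_neighborSet, hnbr', Sym2.eq_swap (a := u), Ne,
      Sym2.congr_right, Set.mem_insert_iff]
    refine ⟨fun h => h.1.resolve_left h.2, fun h => ⟨Or.inr h, ?_⟩⟩
    rintro rfl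
    exact huN h
  have hHφ : AcyclicEC H φ := hHG' ▸ hφ.mono (deleteIncidenceSet_le _ _)
  let g : V → Fin k := fun x => φ s(v, x)
  have hstar : AcyclicStar H φ N g := by
    have := hφ.acyclicStar v
    rwa [hHG', hN'] at this
  have hext : ∀ f, ¬ AcyclicStar H φ (insert u (N : Set V)) f := by
    intro f hf
    rw [← hnbr'] at hf
    exact hG.1 (hf.hasAEC hHφ)
  have hCu : Cset G' φ u = (colorFinset H φ u : Set (Fin k)) := by
    ext c
    rw [Finset.mem_coe, mem_colorFinset]
    simp only [Cset, Set.mem_ofPred_eq, hadj', hadjH, ne_eq, Sym2.congr_right, huv.ne,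
      not_false_eq_true, true_and]
  have hCv : Cset G' φ v = ((N.image g : Finset (Fin k)) : Set (Fin k)) := by
    rw [Finset.coe_image, ← hN']
    rfl
  have hF : ∀ x ∈ N, Fset G' φ v x = (colorFinset H φ x : Set (Fin k)) := by
    intro x hx
    have hxv := (hNadj x hx).ne'
    have hxu : x ≠ u := fun h => huN (h ▸ hx)
    ext c
    rw [Finset.mem_coe, mem_colorFinset]
    simp only [Fset, Cset, Set.mem_ofPred_eq, hadj', hadjH, ne_eq, Sym2.eq_iff, hxv, hxu,
      false_and, or_self, not_false_eq_true, true_and, and_true, and_assoc]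
  have hinter : (colorFinset H φ u ∩ N.image g).card = 2 := by
    rw [hCu, hCv, ← Finset.coe_inter, Set.ncard_coe_finset] at hint
    exact hint
  have hcardN : N.card + 1 = G.degree v := by
    rw [← Finset.card_insert_of_notMem huN, ← card_neighborFinset_eq_degree]
    congr 1
    rw [← Finset.coe_inj, Finset.coe_insert, coe_neighborFinset, hnbr']
  have hcardU : (colorFinset H φ u).card + 1 = G.degree u :=
    hHφ.1.card_colorFinset huv.symm
  have hcardW : (N.image g).card = N.card := Finset.card_image_of_injOn hstar.injOn
  have hunion := Finset.card_union_add_card_inter (colorFinset H φ u) (N.image g)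
  have hfree : ∀ x ∈ N, ∃ α, α ∉ Cset H φ u ∧ (∀ y ∈ N, g y ≠ α) ∧ α ∉ Cset H φ x := by
    intro x hx
    have hx' : (colorFinset H φ x).card + 1 = G.degree x :=
      hHφ.1.card_colorFinset (hNadj x hx)
    have hmax := G.degree_le_maxDegree x
    have hle := Finset.card_union_le (colorFinset H φ u ∪ N.image g) (colorFinset H φ x)
    obtain ⟨α, -, hα⟩ := Finset.exists_mem_notMem_of_card_lt_card
      (s := colorFinset H φ u ∪ N.image g ∪ colorFinset H φ x) (t := Finset.univ)
      (by rw [Finset.card_univ, Fintype.card_fin]; omega)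
    simp only [Finset.mem_union, mem_colorFinset, Finset.mem_image, not_or, not_exists,
      not_and] at hα
    exact ⟨α, hα.1.1, hα.1.2, hα.2⟩
  obtain ⟨a, b, hab, hUW⟩ := Finset.card_eq_two.1 hinter
  have hmem : ∀ c, c ∈ colorFinset H φ u ∧ c ∈ N.image g ↔ c = a ∨ c = b := by
    intro c
    rw [← Finset.mem_inter, hUW, Finset.mem_insert, Finset.mem_singleton]
  obtain ⟨p, hp, rfl⟩ := Finset.mem_image.1 ((hmem a).2 (Or.inl rfl)).2
  obtain ⟨q, hq, rfl⟩ := Finset.mem_image.1 ((hmem b).2 (Or.inr rfl)).2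
  have hpq : p ≠ q := fun h => hab (h ▸ rfl)
  have huniq : ∀ y ∈ N, g y ∈ colorFinset H φ u → y = p ∨ y = q := fun y hy hyu =>
    ((hmem (g y)).1 ⟨hyu, Finset.mem_image_of_mem g hy⟩).imp
      (fun h => hstar.injOn hy hp h) (fun h => hstar.injOn hy hq h)
  have huniq' : ∀ y ∈ N, g y ∈ Cset H φ u → y = p ∨ y = q := fun y hy hyu =>
    huniq y hy (mem_colorFinset.2 hyu)
  have hcount := card_le_sum_card_inter hstar.injOn hp hq hpq huniq
    (hstar.card_lt_card hHφ.1 hext huN hp hq hpq huniq' hfree)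
    (hstar.card_lt_card hHφ.1 hext huN hq hp hpq.symm (fun y hy h => (huniq' y hy h).symm) hfree)
  rw [hcardU, hN, Finset.sum_image hinj.injOn] at hcount
  refine hcount.trans_eq (Finset.sum_congr rfl fun i _ => ?_)
  rw [hF _ (Finset.mem_image_of_mem vi (Finset.mem_univ i)), hCu, hCv, ← Finset.coe_union,
    ← Finset.coe_inter, Set.ncard_coe_finset]
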